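/- arXiv:2605.25169 — 7 statements merged into one kernel-verified Lean document; each statement's English description precedes it below -/
import Mathlib

section
/- Let X, A, Q, Y0, Y1 be random elements on a probability space and let W be a random element independent of the tuple (X, A, Q, Y0, Y1). Assume Q is conditionally independent of (A, Y0, Y1) given X, and A is conditionally independent of (Y0, Y1) given X. Let Z = Φ(A, Q, W) for a measurable function Φ with values in {0,1}. Then Z is conditionally independent of (Y0, Y1) given X. (This is the conditional-randomization part of Theorem 1: the treatment produced by any allocation mechanism depending only on the unit's arrival time, queue assignment, and an independent environment is conditionally randomized given covariates when arrivals are exogenous.) -/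
open MeasureTheory ProbabilityTheory

namespace ProbabilityTheory

variable {Ω α β γ : Type*} {m' : MeasurableSpace Ω} {mΩ : MeasurableSpace Ω}
  {mα : MeasurableSpace α} {mβ : MeasurableSpace β} {mγ : MeasurableSpace γ}
  {μ : Measure Ω} {f : Ω → α} {g : Ω → β} {h : Ω → γ}

/-- If `t` belongs to a σ-algebra independent of one containing `m'` and `s`, then its
probability factors out of the conditional probability of `s ∩ t` given `m'`. -/
lemma condExp_inter_ae_eq_of_indep [IsFiniteMeasure μ] {m₁ m₂ : MeasurableSpace Ω}
    (hm' : m' ≤ m₁) (hm₁ : m₁ ≤ mΩ) (hm₂ : m₂ ≤ mΩ) (hind : Indep m₁ m₂ μ) {s t : Set Ω}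
    (hs : MeasurableSet[m₁] s) (ht : MeasurableSet[m₂] t) :
    μ⟦s ∩ t | m'⟧ =ᵐ[μ] fun ω ↦ μ.real t * (μ⟦s | m'⟧) ω := by
  have hsΩ := hm₁ s hs
  have htΩ := hm₂ t ht
  refine (ae_eq_condExp_of_forall_setIntegral_eq (hm'.trans hm₁) ?_ ?_ ?_ ?_).symm
  · exact (integrable_const _).indicator (hsΩ.inter htΩ)
  · exact fun u _ _ ↦ (integrable_condExp.const_mul _).integrableOn
  · intro u hu _
    rw [integral_const_mul, setIntegral_condExp (hm'.trans hm₁)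
      ((integrable_const _).indicator hsΩ) hu, setIntegral_indicator hsΩ,
      setIntegral_indicator (hsΩ.inter htΩ)]
    simp only [setIntegral_const, smul_eq_mul, mul_one]
    rw [← Set.inter_assoc, measureReal_def, measureReal_def, measureReal_def,
      (Indep_iff _ _ μ).1 hind _ _ ((hm' u hu).inter hs) ht, ENNReal.toReal_mul, mul_comm]
  · exact (stronglyMeasurable_condExp.const_mul _).aestronglyMeasurable

variable {hm' : m' ≤ mΩ} [StandardBorelSpace Ω] [IsFiniteMeasure μ]

/-- Conditional independence of a pair from a third function can be checked on rectangles. -/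
lemma CondIndepFun.prodMk_left_of_condExp_inter_preimage (hf : Measurable f) (hg : Measurable g)
    (hh : Measurable h)
    (H : ∀ s t u, MeasurableSet s → MeasurableSet t → MeasurableSet u →
      μ⟦(f ⁻¹' s ∩ g ⁻¹' t) ∩ h ⁻¹' u | m'⟧ =ᵐ[μ]
        fun ω ↦ (μ⟦f ⁻¹' s ∩ g ⁻¹' t | m'⟧) ω * (μ⟦h ⁻¹' u | m'⟧) ω) :
    CondIndepFun m' hm' (fun ω ↦ (f ω, g ω)) h μ := by
  have hfg : Measurable fun ω ↦ (f ω, g ω) := hf.prodMk hg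
  rw [condIndepFun_iff_condIndep]
  refine CondIndepSets.condIndep hfg.comap_le hh.comap_le
    (isPiSystem_prod.comap fun ω ↦ (f ω, g ω)) (@MeasurableSpace.isPiSystem_measurableSet Ω
      (mγ.comap h))
    (by rw [← generateFrom_prod, MeasurableSpace.comap_generateFrom]; rfl)
    (@MeasurableSpace.generateFrom_measurableSet Ω (mγ.comap h)).symm ?_
  rw [condIndepSets_iff]
  · rintro _ _ ⟨_, ⟨s, hs, t, ht, rfl⟩, rfl⟩ ⟨u, hu, rfl⟩
    exact H s t u hs ht hu
  · rintro _ ⟨_, ⟨s, hs, t, ht, rfl⟩, rfl⟩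
    exact hfg (hs.prod ht)
  · exact fun v hv ↦ hh.comap_le v hv

/-- The contraction property of conditional independence. -/
lemma CondIndepFun.prodMk_left (hf : Measurable f) (hg : Measurable g) (hh : Measurable h)
    (hfh : CondIndepFun m' hm' f h μ)
    (hgfh : CondIndepFun m' hm' g (fun ω ↦ (f ω, h ω)) μ) :
    CondIndepFun m' hm' (fun ω ↦ (f ω, g ω)) h μ := by
  refine .prodMk_left_of_condExp_inter_preimage hf hg hh fun s t u hs ht hu ↦ ?_
  rw [condIndepFun_iff_condExp_inter_preimage_eq_mul hf hh] at hfh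
  rw [condIndepFun_iff_condExp_inter_preimage_eq_mul hg (hf.prodMk hh)] at hgfh
  have hgfh_inter := hgfh t (s ×ˢ u) ht (hs.prod hu)
  have hgf_inter := hgfh t (s ×ˢ Set.univ) ht (hs.prod .univ)
  simp only [Set.mk_preimage_prod, Set.preimage_univ, Set.inter_univ] at hgfh_inter hgf_inter
  rw [Set.inter_comm (f ⁻¹' s), Set.inter_assoc]
  filter_upwards [hgfh_inter, hgf_inter, hfh s u hs hu] with ω h₁ h₂ h₃
  rw [h₁, h₂, h₃, mul_assoc]

/-- Conditional independence of `f` and `h` given `m'` is preserved when `f` is paired with a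
function that is independent of `m'`, `f` and `h` jointly. -/
lemma CondIndepFun.prodMk_left_of_indep {m₁ : MeasurableSpace Ω} (hm'₁ : m' ≤ m₁) (hm₁ : m₁ ≤ mΩ)
    (hf : Measurable[m₁] f) (hg : Measurable[mΩ] g) (hh : Measurable[m₁] h)
    (hind : Indep m₁ (mβ.comap g) μ) (hfh : CondIndepFun m' hm' f h μ) :
    CondIndepFun m' hm' (fun ω ↦ (f ω, g ω)) h μ := by
  have hfΩ := hf.mono hm₁ le_rfl
  have hhΩ := hh.mono hm₁ le_rfl
  refine .prodMk_left_of_condExp_inter_preimage hfΩ hg hhΩ fun s t u hs ht hu ↦ ?_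
  rw [condIndepFun_iff_condExp_inter_preimage_eq_mul hfΩ hhΩ] at hfh
  have htg : MeasurableSet[mβ.comap g] (g ⁻¹' t) := ⟨t, ht, rfl⟩
  rw [Set.inter_right_comm]
  filter_upwards [hfh s u hs hu,
    condExp_inter_ae_eq_of_indep hm'₁ hm₁ hg.comap_le hind ((hf hs).inter (hh hu)) htg,
    condExp_inter_ae_eq_of_indep hm'₁ hm₁ hg.comap_le hind (hf hs) htg] with ω h₁ h₂ h₃
  rw [h₂, h₁, h₃, mul_assoc]

end ProbabilityTheory

/-- conditional-randomization part of Theorem 1.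
If `W` is independent of `(X, A, Q, Y0, Y1)`, `Q ⫫ (A, Y0, Y1) | X`, `A ⫫ (Y0, Y1) | X`
(exogenous arrivals), and the treatment `Z = Φ(A, Q, W)` for a measurable `{0,1}`-valued `Φ`,
then `Z ⫫ (Y0, Y1) | X`. -/
theorem conditional_randomization_of_exogenous_arrivals
    {Ω E 𝒜 𝒬 𝒲 : Type*} [MeasurableSpace Ω] [StandardBorelSpace Ω]
    [MeasurableSpace E] [MeasurableSpace 𝒜] [MeasurableSpace 𝒬] [MeasurableSpace 𝒲]
    (μ : Measure Ω) [IsProbabilityMeasure μ]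
    (X : Ω → E) (A : Ω → 𝒜) (Q : Ω → 𝒬) (W : Ω → 𝒲) (Y0 Y1 : Ω → ℝ)
    (hXm : Measurable X) (hAm : Measurable A) (hQm : Measurable Q) (hWm : Measurable W)
    (hY0m : Measurable Y0) (hY1m : Measurable Y1)
    (hX : MeasurableSpace.comap X inferInstance ≤ (inferInstance : MeasurableSpace Ω))
    (Φ : 𝒜 × 𝒬 × 𝒲 → ℝ) (hΦm : Measurable Φ) (hΦ01 : ∀ v, Φ v = 0 ∨ Φ v = 1)
    (Z : Ω → ℝ) (hZ : ∀ ω, Z ω = Φ (A ω, Q ω, W ω))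
    (hW : IndepFun W (fun ω => (X ω, A ω, Q ω, Y0 ω, Y1 ω)) μ)
    (hQCI : CondIndepFun (MeasurableSpace.comap X inferInstance) hX Q
      (fun ω => (A ω, Y0 ω, Y1 ω)) μ)
    (hACI : CondIndepFun (MeasurableSpace.comap X inferInstance) hX A
      (fun ω => (Y0 ω, Y1 ω)) μ) :
    CondIndepFun (MeasurableSpace.comap X inferInstance) hX Z
      (fun ω => (Y0 ω, Y1 ω)) μ := by
  have hY := hY0m.prodMk hY1m
  have hAQ := CondIndepFun.prodMk_left hAm hQm hY hACI hQCI
  let V := fun ω ↦ (X ω, A ω, Q ω, Y0 ω, Y1 ω)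
  have hV : Measurable V := hXm.prodMk (hAm.prodMk (hQm.prodMk hY))
  have hVc : Measurable[MeasurableSpace.comap V inferInstance] V := comap_measurable V
  have hXV : MeasurableSpace.comap X inferInstance ≤ MeasurableSpace.comap V inferInstance :=
    (measurable_fst.comp hVc).comap_le
  have hAQV : Measurable[MeasurableSpace.comap V inferInstance] fun ω ↦ (A ω, Q ω) :=
    (show Measurable fun v : E × 𝒜 × 𝒬 × ℝ × ℝ ↦ (v.2.1, v.2.2.1) by fun_prop).comp hVc
  have hYV : Measurable[MeasurableSpace.comap V inferInstance] fun ω ↦ (Y0 ω, Y1 ω) :=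
    (show Measurable fun v : E × 𝒜 × 𝒬 × ℝ × ℝ ↦ v.2.2.2 by fun_prop).comp hVc
  have hAQW := CondIndepFun.prodMk_left_of_indep hXV hV.comap_le hAQV hWm hYV hW.symm hAQ
  have hΨ : Measurable fun p : (𝒜 × 𝒬) × 𝒲 ↦ Φ (p.1.1, p.1.2, p.2) := by fun_prop
  obtain rfl : Z = fun ω ↦ Φ (A ω, Q ω, W ω) := funext hZ
  exact hAQW.comp hΨ measurable_id
end

section
/- Potential-outcomes setup: X is a random element, Z is a {0,1}-valued random variable, Y0 and Y1 are integrable real-valued random variables, and the observed outcome is Y = Z·Y1 + (1−Z)·Y0. Suppose Z is conditionally independent of (Y0, Y1) given X, and let π(X) denote (a version of) the conditional expectation E[Z | X]. If there exists γ > 0 such that γ ≤ π(X) ≤ 1−γ almost surely, then the average treatment effect is identified by inverse-propensity weighting: E[Y1 − Y0] = E[ Z·Y / π(X) − (1−Z)·Y / (1−π(X)) ]. -/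
open MeasureTheory ProbabilityTheory

section InverseProbabilityWeighting

variable {Ω β : Type*} {m mΩ : MeasurableSpace Ω} [MeasurableSpace β]
  {μ : Measure Ω} [IsProbabilityMeasure μ] {f : Ω → β} {W q : Ω → ℝ} {s : Set β} {γ : ℝ}

/-- Weighting an event by its inverse conditional probability preserves the probability of every
conditionally independent event. -/
lemma integral_indicator_inter_div_condExp {A B : Set Ω} (hm : m ≤ mΩ)
    (hA : MeasurableSet A) (hB : MeasurableSet B)
    (hAB : μ[(A ∩ B).indicator (fun _ => (1 : ℝ)) | m]
      =ᵐ[μ] μ[A.indicator (fun _ => (1 : ℝ)) | m] * μ[B.indicator (fun _ => (1 : ℝ)) | m])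
    (hq : q =ᵐ[μ] μ[A.indicator (fun _ => (1 : ℝ)) | m])
    (hγ : 0 < γ) (hqγ : ∀ᵐ ω ∂μ, γ ≤ q ω) :
    ∫ ω in B, A.indicator (fun _ => (1 : ℝ)) ω / q ω ∂μ = μ.real B := by
  set r : Ω → ℝ := μ[A.indicator (fun _ => (1 : ℝ)) | m]
  have hrm : StronglyMeasurable[m] r⁻¹ :=
    stronglyMeasurable_condExp.measurable.inv.stronglyMeasurable
  have hint : Integrable ((A ∩ B).indicator (fun _ => (1 : ℝ))) μ :=
    (integrable_const 1).indicator (hA.inter hB)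
  have hint' : Integrable (r⁻¹ * (A ∩ B).indicator (fun _ => (1 : ℝ))) μ := by
    refine hint.bdd_mul (c := γ⁻¹) (hrm.mono hm).aestronglyMeasurable ?_
    filter_upwards [hq, hqγ] with ω h1 h2
    rw [h1] at h2
    rw [Pi.inv_apply, Real.norm_of_nonneg (inv_nonneg.2 (hγ.le.trans h2))]
    exact inv_anti₀ hγ h2
  calc ∫ ω in B, A.indicator (fun _ => (1 : ℝ)) ω / q ω ∂μ
      = ∫ ω, (r⁻¹ * (A ∩ B).indicator (fun _ => (1 : ℝ))) ω ∂μ := by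
        rw [← integral_indicator hB]
        refine integral_congr_ae ?_
        filter_upwards [hq] with ω h1
        by_cases hωA : ω ∈ A <;> by_cases hωB : ω ∈ B <;> simp [hωA, hωB, h1]
    _ = ∫ ω, (μ[r⁻¹ * (A ∩ B).indicator (fun _ => (1 : ℝ)) | m]) ω ∂μ :=
        (integral_condExp hm).symm
    _ = ∫ ω, (μ[B.indicator (fun _ => (1 : ℝ)) | m]) ω ∂μ := by
        refine integral_congr_ae ?_
        filter_upwards [condExp_mul_of_stronglyMeasurable_left hrm hint' hint, hAB, hq, hqγ]
          with ω h1 h2 h3 h4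
        have : r ω ≠ 0 := by rw [← h3]; exact (hγ.trans_le h4).ne'
        rw [h1, Pi.mul_apply, h2, Pi.mul_apply, Pi.inv_apply, inv_mul_cancel_left₀ this]
    _ = μ.real B := by
        rw [integral_condExp hm, integral_indicator hB]
        simp

/-- Inverse probability weighting: if `f` and `W` are conditionally independent and the
conditional probability `q` of `f ∈ s` is bounded away from zero, then `W` weighted by the
indicator of `f ∈ s` over `q` is integrable with the same mean as `W`. -/
lemma integral_indicator_div_condExp_mul [StandardBorelSpace Ω] (hm : m ≤ mΩ)
    (hf : Measurable f) (hW : Measurable W) (hWi : Integrable W μ) (hs : MeasurableSet s)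
    (h : CondIndepFun m hm f W μ)
    (hq : q =ᵐ[μ] μ[(f ⁻¹' s).indicator (fun _ => (1 : ℝ)) | m])
    (hγ : 0 < γ) (hqγ : ∀ᵐ ω ∂μ, γ ≤ q ω) :
    Integrable (fun ω => (f ⁻¹' s).indicator (fun _ => (1 : ℝ)) ω / q ω * W ω) μ ∧
      ∫ ω, (f ⁻¹' s).indicator (fun _ => (1 : ℝ)) ω / q ω * W ω ∂μ = ∫ ω, W ω ∂μ := by
  set A := f ⁻¹' s
  have hA : MeasurableSet A := hf hs
  set w : Ω → ℝ := fun ω => A.indicator (fun _ => (1 : ℝ)) ω / q ω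
  have hqm : AEMeasurable q μ :=
    ((stronglyMeasurable_condExp.mono hm).measurable.aemeasurable).congr hq.symm
  have hwm : AEMeasurable w μ := ((measurable_const.indicator hA).aemeasurable).div hqm
  have hw0 : ∀ᵐ ω ∂μ, 0 ≤ w ω := by
    filter_upwards [hqγ] with ω h1
    exact div_nonneg (Set.indicator_nonneg (fun _ _ => zero_le_one) _) (hγ.le.trans h1)
  have hwb : ∀ᵐ ω ∂μ, ‖w ω‖ ≤ γ⁻¹ := by
    filter_upwards [hqγ, hw0] with ω h1 h2
    rw [Real.norm_of_nonneg h2, ← one_div]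
    exact div_le_div₀ zero_le_one (Set.indicator_le_self' (fun _ _ => zero_le_one) _) hγ h1
  have hwi : Integrable w μ := Integrable.of_bound hwm.aestronglyMeasurable _ hwb
  refine ⟨hWi.bdd_mul hwm.aestronglyMeasurable hwb, ?_⟩
  have hmap : (μ.withDensity fun ω => ENNReal.ofReal (w ω)).map W = μ.map W := by
    ext t ht
    rw [Measure.map_apply hW ht, Measure.map_apply hW ht, withDensity_apply _ (hW ht),
      ← ofReal_integral_eq_lintegral_ofReal hwi.integrableOn (ae_restrict_of_ae hw0),
      integral_indicator_inter_div_condExp hm hA (hW ht)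
        ((condIndepFun_iff_condExp_inter_preimage_eq_mul hf hW).1 h s t hs ht) hq hγ hqγ,
      ofReal_measureReal]
  calc ∫ ω, w ω * W ω ∂μ
      = ∫ ω, W ω ∂(μ.withDensity fun ω => ENNReal.ofReal (w ω)) := by
        rw [integral_withDensity_eq_integral_toReal_smul₀ hwm.ennreal_ofReal (by simp)]
        refine integral_congr_ae ?_
        filter_upwards [hw0] with ω h1
        rw [ENNReal.toReal_ofReal h1, smul_eq_mul]
    _ = ∫ x, x ∂((μ.withDensity fun ω => ENNReal.ofReal (w ω)).map W) :=
        (integral_map hW.aemeasurable aestronglyMeasurable_id).symm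
    _ = ∫ ω, W ω ∂μ := by
        rw [hmap]
        exact integral_map hW.aemeasurable aestronglyMeasurable_id

end InverseProbabilityWeighting

/-- identification part of Theorem 1: IPW identification of the ATE.
If `Z ⫫ (Y0, Y1) | X` (conditional randomization), `p` is a version of `E[Z | X]` with
`γ ≤ p ≤ 1 - γ` a.s. (positivity), and `Y = Z·Y1 + (1-Z)·Y0` is the observed outcome, then
`E[Y1 - Y0] = E[Z·Y/p(X) - (1-Z)·Y/(1-p(X))]`. -/
theorem ate_identified_by_ipw
    {Ω E : Type*} [MeasurableSpace Ω] [StandardBorelSpace Ω] [MeasurableSpace E]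
    (μ : Measure Ω) [IsProbabilityMeasure μ]
    (X : Ω → E) (Z Y0 Y1 : Ω → ℝ)
    (hXm : Measurable X) (hZm : Measurable Z)
    (hZ01 : ∀ ω, Z ω = 0 ∨ Z ω = 1)
    (hY0 : Integrable Y0 μ) (hY1 : Integrable Y1 μ)
    (hY0m : Measurable Y0) (hY1m : Measurable Y1)
    (Y : Ω → ℝ) (hYdef : ∀ ω, Y ω = Z ω * Y1 ω + (1 - Z ω) * Y0 ω)
    (hX : MeasurableSpace.comap X inferInstance ≤ (inferInstance : MeasurableSpace Ω))
    (hCI : CondIndepFun (MeasurableSpace.comap X inferInstance) hX Z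
      (fun ω => (Y0 ω, Y1 ω)) μ)
    (p : Ω → ℝ) (hp : p =ᵐ[μ] μ[Z | MeasurableSpace.comap X inferInstance])
    (γ : ℝ) (hγ : 0 < γ)
    (hpos : ∀ᵐ ω ∂μ, γ ≤ p ω ∧ p ω ≤ 1 - γ) :
    ∫ ω, (Y1 ω - Y0 ω) ∂μ
      = ∫ ω, (Z ω * Y ω / p ω - (1 - Z ω) * Y ω / (1 - p ω)) ∂μ := by
  have hZ1 : (Z ⁻¹' {1}).indicator (fun _ => (1 : ℝ)) = Z := by
    ext ω
    rcases hZ01 ω with h | h <;> simp [Set.indicator, h]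
  have hZ0 : (Z ⁻¹' {0}).indicator (fun _ => (1 : ℝ)) = (fun _ => 1) - Z := by
    ext ω
    rcases hZ01 ω with h | h <;> simp [Set.indicator, h]
  have hZi : Integrable Z μ := by
    rw [← hZ1]
    exact (integrable_const 1).indicator (hZm (measurableSet_singleton 1))
  have hq : (fun ω => 1 - p ω) =ᵐ[μ]
      μ[(fun _ => (1 : ℝ)) - Z | MeasurableSpace.comap X inferInstance] := by
    filter_upwards [hp, condExp_sub (integrable_const (1 : ℝ)) hZi
      (MeasurableSpace.comap X inferInstance)] with ω h1 h2
    rw [h2, Pi.sub_apply, condExp_const hX, h1]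
  obtain ⟨hi1, he1⟩ := integral_indicator_div_condExp_mul (s := {1}) (q := p) hX hZm hY1m hY1
    (measurableSet_singleton 1) (hCI.comp measurable_id measurable_snd) (by rwa [hZ1]) hγ
    (hpos.mono fun _ h => h.1)
  obtain ⟨hi0, he0⟩ := integral_indicator_div_condExp_mul (s := {0}) (q := fun ω => 1 - p ω)
    hX hZm hY0m hY0 (measurableSet_singleton 0) (hCI.comp measurable_id measurable_fst)
    (by rwa [hZ0]) hγ (hpos.mono fun _ h => by linarith [h.2])
  rw [integral_sub hY1 hY0, ← he1, ← he0, ← integral_sub hi1 hi0, hZ1, hZ0]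
  refine integral_congr_ae (.of_forall fun ω => ?_)
  rcases hZ01 ω with h | h <;> simp [hYdef, h, div_eq_mul_inv, mul_comm]
end

section
/- Let X and Q be random elements, Z a {0,1}-valued random variable, and U an integrable real random variable with E[U | X, Q] = 0 almost surely (conditional expectation with respect to the σ-algebra generated by (X,Q)). Let the outcome satisfy the partially linear IV model Y = ψ·Z + g(X) + U for a constant ψ ∈ ℝ and a measurable function g with g(X) integrable. Let m(X) = E[Y | X] and π(X) = E[Z | X], and let f(X,Q) be a bounded measurable function of (X,Q) with E[f(X,Q) | X] = 0 almost surely. Then E[f(X,Q)·(Z − π(X))] = E[f(X,Q)·Z], and if E[f(X,Q)·Z] ≠ 0 then ψ = E[f(X,Q)·(Y − m(X))] / E[f(X,Q)·(Z − π(X))]. -/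
open MeasureTheory ProbabilityTheory

/-- A function with vanishing conditional expectation is orthogonal to every function measurable
with respect to the conditioning σ-algebra. -/
theorem integral_mul_eq_zero_of_condExp_eq_zero {Ω : Type*} {m m₀ : MeasurableSpace Ω}
    {μ : Measure Ω} [IsFiniteMeasure μ] (hm : m ≤ m₀) {a b : Ω → ℝ}
    (ha : StronglyMeasurable[m] a) (hb : Integrable b μ) (hab : Integrable (fun ω => a ω * b ω) μ)
    (h : μ[b | m] =ᵐ[μ] 0) : ∫ ω, a ω * b ω ∂μ = 0 := by
  have key : μ[fun ω => a ω * b ω | m] =ᵐ[μ] 0 := by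
    filter_upwards [condExp_mul_of_stronglyMeasurable_left ha hab hb, h] with ω h₁ h₂
    exact h₁.trans (by simp [h₂])
  rw [← integral_condExp hm, integral_congr_ae key]
  simp

/-- moment identification in the partially linear IV model.
If `Y = ψ·Z + g(X) + U` with `E[U | X, Q] = 0`, `m = E[Y | X]`, `piX = E[Z | X]`, and
`f(X,Q)` is a bounded measurable function of `(X,Q)` with `E[f(X,Q) | X] = 0`, then
`E[f·(Z - piX)] = E[f·Z]`, and if `E[f·Z] ≠ 0` then
`ψ = E[f·(Y - m)] / E[f·(Z - piX)]`. -/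
theorem pliv_moment_identification
    {Ω E F : Type*} [MeasurableSpace Ω] [MeasurableSpace E] [MeasurableSpace F]
    (μ : Measure Ω) [IsProbabilityMeasure μ]
    (X : Ω → E) (Qv : Ω → F) (Z U : Ω → ℝ) (ψ : ℝ) (g : E → ℝ)
    (hXm : Measurable X) (hQm : Measurable Qv) (hZm : Measurable Z)
    (hZ01 : ∀ ω, Z ω = 0 ∨ Z ω = 1)
    (hU : Integrable U μ)
    (hgm : Measurable g) (hgint : Integrable (fun ω => g (X ω)) μ)
    (hUcond : μ[U | MeasurableSpace.comap (fun ω => (X ω, Qv ω)) inferInstance] =ᵐ[μ] 0)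
    (Y : Ω → ℝ) (hY : ∀ ω, Y ω = ψ * Z ω + g (X ω) + U ω)
    (m piX : Ω → ℝ)
    (hm : m = μ[Y | MeasurableSpace.comap X inferInstance])
    (hpi : piX = μ[Z | MeasurableSpace.comap X inferInstance])
    (fXQ : E × F → ℝ) (hfm : Measurable fXQ) (Cf : ℝ) (hfb : ∀ v, |fXQ v| ≤ Cf)
    (f : Ω → ℝ) (hf : ∀ ω, f ω = fXQ (X ω, Qv ω))
    (hfcond : μ[f | MeasurableSpace.comap X inferInstance] =ᵐ[μ] 0) :
    (∫ ω, f ω * (Z ω - piX ω) ∂μ = ∫ ω, f ω * Z ω ∂μ)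
    ∧ (∫ ω, f ω * Z ω ∂μ ≠ 0 →
        ψ = (∫ ω, f ω * (Y ω - m ω) ∂μ) / (∫ ω, f ω * (Z ω - piX ω) ∂μ)) := by
  have hX : MeasurableSpace.comap X inferInstance ≤ ‹MeasurableSpace Ω› := hXm.comap_le
  have hXQ : MeasurableSpace.comap (fun ω => (X ω, Qv ω)) inferInstance ≤ ‹MeasurableSpace Ω› :=
    (hXm.prodMk hQm).comap_le
  obtain rfl : f = fun ω => fXQ (X ω, Qv ω) := funext hf
  have hfmeas : Measurable fun ω => fXQ (X ω, Qv ω) := hfm.comp (hXm.prodMk hQm)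
  have hmul {h : Ω → ℝ} (hh : Integrable h μ) :
      Integrable (fun ω => fXQ (X ω, Qv ω) * h ω) μ :=
    hh.bdd_mul hfmeas.aestronglyMeasurable (ae_of_all _ fun ω => hfb _)
  have hfint : Integrable (fun ω => fXQ (X ω, Qv ω)) μ :=
    .of_bound hfmeas.aestronglyMeasurable Cf (ae_of_all _ fun ω => hfb _)
  have horth {h : Ω → ℝ} (hh : Integrable h μ)
      (hmeas : StronglyMeasurable[MeasurableSpace.comap X inferInstance] h) :
      ∫ ω, fXQ (X ω, Qv ω) * h ω ∂μ = 0 := by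
    simp_rw [mul_comm (fXQ _)]
    exact integral_mul_eq_zero_of_condExp_eq_zero hX hmeas hfint
      (by simpa only [mul_comm] using hmul hh) hfcond
  have hZ : Integrable Z μ := .of_bound hZm.aestronglyMeasurable 1
    (ae_of_all _ fun ω => by rcases hZ01 ω with h | h <;> simp [h])
  have hpiint : Integrable piX μ := hpi ▸ integrable_condExp
  have hmint : Integrable m μ := hm ▸ integrable_condExp
  have hpi0 : ∫ ω, fXQ (X ω, Qv ω) * piX ω ∂μ = 0 :=
    horth hpiint (hpi ▸ stronglyMeasurable_condExp)
  have hm0 : ∫ ω, fXQ (X ω, Qv ω) * m ω ∂μ = 0 :=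
    horth hmint (hm ▸ stronglyMeasurable_condExp)
  have hg0 : ∫ ω, fXQ (X ω, Qv ω) * g (X ω) ∂μ = 0 :=
    horth hgint (hgm.comp (comap_measurable X)).stronglyMeasurable
  have hU0 : ∫ ω, fXQ (X ω, Qv ω) * U ω ∂μ = 0 :=
    integral_mul_eq_zero_of_condExp_eq_zero hXQ
      (hfm.comp (comap_measurable fun ω => (X ω, Qv ω))).stronglyMeasurable hU (hmul hU) hUcond
  have hden : ∫ ω, fXQ (X ω, Qv ω) * (Z ω - piX ω) ∂μ = ∫ ω, fXQ (X ω, Qv ω) * Z ω ∂μ := by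
    simp_rw [mul_sub]
    rw [integral_sub (hmul hZ) (hmul hpiint), hpi0, sub_zero]
  have hnum : ∫ ω, fXQ (X ω, Qv ω) * (Y ω - m ω) ∂μ = ψ * ∫ ω, fXQ (X ω, Qv ω) * Z ω ∂μ := by
    have hψZ := (hmul hZ).const_mul ψ
    have hψZg := hψZ.fun_add (hmul hgint)
    have hψZgU := hψZg.fun_add (hmul hU)
    calc ∫ ω, fXQ (X ω, Qv ω) * (Y ω - m ω) ∂μ
        = ∫ ω, (ψ * (fXQ (X ω, Qv ω) * Z ω) + fXQ (X ω, Qv ω) * g (X ω)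
            + fXQ (X ω, Qv ω) * U ω) - fXQ (X ω, Qv ω) * m ω ∂μ := by
          congr with ω
          rw [hY]
          ring
      _ = ψ * ∫ ω, fXQ (X ω, Qv ω) * Z ω ∂μ := by
          rw [integral_sub hψZgU (hmul hmint), integral_add hψZg (hmul hU),
            integral_add hψZ (hmul hgint), integral_const_mul, hg0, hU0, hm0]
          ring
  refine ⟨hden, fun hne => ?_⟩
  rw [hden, hnum, mul_div_cancel_right₀ _ hne]
end

section
/- Let ζ, σ, and f be real-valued random variables on a probability space with σ > 0 almost surely, 0 < E[ζ²/σ] < ∞, E[f²·σ] < ∞, and E[f·ζ] ≠ 0. Then E[f²·σ] / (E[f·ζ])² ≥ 1 / E[ζ²/σ], and equality holds if and only if f = c·ζ/σ almost surely for some nonzero constant c. (Applied with ζ the recentered instrument and σ the conditional outcome variance, this shows that ζ/σ is, up to multiplicative scaling, the unique instrument attaining the efficiency bound for the partially linear IV model.) -/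
open MeasureTheory

/-- Expansion of a weighted square: the integral of `(f σ - t ζ)² / σ` as a quadratic in `t`. -/
theorem integrable_and_integral_weighted_sub_sq {Ω : Type*} [MeasurableSpace Ω] {μ : Measure Ω}
    {ζ σ f : Ω → ℝ} (hσpos : ∀ᵐ ω ∂μ, 0 < σ ω)
    (hζ : Integrable (fun ω => ζ ω ^ 2 / σ ω) μ)
    (hf : Integrable (fun ω => f ω ^ 2 * σ ω) μ)
    (hfζ : Integrable (fun ω => f ω * ζ ω) μ) (t : ℝ) :
    Integrable (fun ω => (f ω * σ ω - t * ζ ω) ^ 2 / σ ω) μ ∧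
      ∫ ω, (f ω * σ ω - t * ζ ω) ^ 2 / σ ω ∂μ =
        (∫ ω, f ω ^ 2 * σ ω ∂μ) - 2 * t * (∫ ω, f ω * ζ ω ∂μ)
          + t ^ 2 * ∫ ω, ζ ω ^ 2 / σ ω ∂μ := by
  have hexp : (fun ω => f ω ^ 2 * σ ω - 2 * t * (f ω * ζ ω) + t ^ 2 * (ζ ω ^ 2 / σ ω)) =ᵐ[μ]
      fun ω => (f ω * σ ω - t * ζ ω) ^ 2 / σ ω := by
    filter_upwards [hσpos] with ω hω
    field_simp
    ring
  have hsub : Integrable (fun ω => f ω ^ 2 * σ ω - 2 * t * (f ω * ζ ω)) μ :=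
    hf.sub (hfζ.const_mul _)
  refine ⟨(hsub.add (hζ.const_mul _)).congr hexp, ?_⟩
  rw [← integral_congr_ae hexp, integral_add hsub (hζ.const_mul _),
    integral_sub hf (hfζ.const_mul _), integral_const_mul, integral_const_mul]

/-- Theorem 3: optimal instrument via Cauchy–Schwarz.
If `σ > 0` a.s., `0 < E[ζ²/σ] < ∞`, `E[f²·σ] < ∞` and `E[f·ζ] ≠ 0`, then
`E[f²·σ]/(E[f·ζ])² ≥ 1/E[ζ²/σ]`, with equality iff `f = c·ζ/σ` a.s. for some `c ≠ 0`. -/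
theorem optimal_instrument_cauchy_schwarz
    {Ω : Type*} [MeasurableSpace Ω] (μ : Measure Ω) [IsProbabilityMeasure μ]
    (ζ σ f : Ω → ℝ)
    (hζm : Measurable ζ) (hσm : Measurable σ) (hfm : Measurable f)
    (hσpos : ∀ᵐ ω ∂μ, 0 < σ ω)
    (hint1 : Integrable (fun ω => ζ ω ^ 2 / σ ω) μ)
    (hpos : 0 < ∫ ω, ζ ω ^ 2 / σ ω ∂μ)
    (hint2 : Integrable (fun ω => f ω ^ 2 * σ ω) μ)
    (hne : ∫ ω, f ω * ζ ω ∂μ ≠ 0) :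
    (1 / ∫ ω, ζ ω ^ 2 / σ ω ∂μ
      ≤ (∫ ω, f ω ^ 2 * σ ω ∂μ) / (∫ ω, f ω * ζ ω ∂μ) ^ 2)
    ∧ ((∫ ω, f ω ^ 2 * σ ω ∂μ) / (∫ ω, f ω * ζ ω ∂μ) ^ 2
          = 1 / ∫ ω, ζ ω ^ 2 / σ ω ∂μ
        ↔ ∃ c : ℝ, c ≠ 0 ∧ f =ᵐ[μ] fun ω => c * ζ ω / σ ω) := by
  have hfζ : Integrable (fun ω => f ω * ζ ω) μ := by
    by_contra h
    exact hne (integral_undef h)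
  have hexp := integrable_and_integral_weighted_sub_sq hσpos hint1 hint2 hfζ
  have hnn (t : ℝ) : 0 ≤ᵐ[μ] fun ω => (f ω * σ ω - t * ζ ω) ^ 2 / σ ω := by
    filter_upwards [hσpos] with ω hω
    exact div_nonneg (sq_nonneg _) hω.le
  have hB : ∀ c : ℝ, (f =ᵐ[μ] fun ω => c * ζ ω / σ ω) →
      ∫ ω, f ω * ζ ω ∂μ = c * ∫ ω, ζ ω ^ 2 / σ ω ∂μ := by
    intro c hc
    rw [← integral_const_mul]
    refine integral_congr_ae ?_
    filter_upwards [hc] with ω hω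
    rw [hω]
    ring
  have hC : ∀ c : ℝ, (f =ᵐ[μ] fun ω => c * ζ ω / σ ω) →
      ∫ ω, f ω ^ 2 * σ ω ∂μ = c ^ 2 * ∫ ω, ζ ω ^ 2 / σ ω ∂μ := by
    intro c hc
    rw [← integral_const_mul]
    refine integral_congr_ae ?_
    filter_upwards [hc, hσpos] with ω hω hpos
    rw [hω]
    field_simp
  set A := ∫ ω, ζ ω ^ 2 / σ ω ∂μ
  set B := ∫ ω, f ω * ζ ω ∂μ
  set C := ∫ ω, f ω ^ 2 * σ ω ∂μ
  have hB2 : 0 < B ^ 2 := by positivity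
  have hmin : ∫ ω, (f ω * σ ω - B / A * ζ ω) ^ 2 / σ ω ∂μ = (C * A - B ^ 2) / A := by
    rw [(hexp (B / A)).2]
    field_simp
    ring
  refine ⟨?_, ?_⟩
  · have h := integral_nonneg_of_ae (hnn (B / A))
    rw [hmin, le_div_iff₀ hpos] at h
    rw [div_le_div_iff₀ hpos hB2]
    linarith
  · rw [div_eq_div_iff hB2.ne' hpos.ne']
    constructor
    · intro h
      refine ⟨B / A, div_ne_zero hne hpos.ne', ?_⟩
      have h0 : ∫ ω, (f ω * σ ω - B / A * ζ ω) ^ 2 / σ ω ∂μ = 0 := by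
        rw [hmin, h]
        simp
      rw [integral_eq_zero_iff_of_nonneg_ae (hnn _) (hexp _).1] at h0
      filter_upwards [h0, hσpos] with ω hω hpos
      rw [eq_div_iff hpos.ne']
      simpa [hpos.ne', sub_eq_zero] using hω
    · rintro ⟨c, -, hc⟩
      rw [hB c hc, hC c hc]
      ring
end

section
/- Let τ ∈ ℕ and let a : {0,1,...,τ} → ℝ be nondecreasing with a_0 = 0. Let c ≥ 0 and β ≥ 0 be constants. For each n, let N_{·,n}, B_{·,n} : {0,...,τ} → ℝ with N_{0,n} = B_{0,n} = 0, and suppose max_{0≤t≤τ} |N_{t,n} − c·a_t| → 0 and max_{0≤t≤τ} |B_{t,n} − β·a_t| → 0 as n → ∞. Define W_{t,n} = max over s ∈ {0,...,t} of (N_{t,n} − N_{s,n}) − (B_{t,n} − B_{s,n}), and T_{t,n} = N_{t,n} − W_{t,n}. Then max_{0≤t≤τ} |W_{t,n} − (c−β)_+·a_t| → 0 and max_{0≤t≤τ} |T_{t,n} − min{β, c}·a_t| → 0 as n → ∞, where u_+ = max{u, 0}. -/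
open Filter Topology

/-- If `f s` is within `ε` of `d * (a t - a s)` for all `s ≤ t`, where `0 = a 0 ≤ a s ≤ a t`, then
the maximum of `f` over `{0, …, t}` is within `ε` of `max d 0 * a t`. -/
theorem abs_sup'_range_sub_max_zero_mul_le {a f : ℕ → ℝ} {d ε : ℝ} {t : ℕ} (ha0 : a 0 = 0)
    (ha : ∀ s ≤ t, 0 ≤ a s ∧ a s ≤ a t) (hf : ∀ s ≤ t, |f s - d * (a t - a s)| ≤ ε)
    (h : (Finset.range (t + 1)).Nonempty) :
    |(Finset.range (t + 1)).sup' h f - max d 0 * a t| ≤ ε := by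
  have hle : ∀ s ≤ t, f s ≤ (Finset.range (t + 1)).sup' h f := fun s hs =>
    Finset.le_sup' f (Finset.mem_range.mpr (Nat.lt_succ_of_le hs))
  rw [abs_le]
  constructor
  · rcases le_total 0 d with hd | hd
    · have h0 := (abs_le.mp (hf 0 t.zero_le)).1
      have := hle 0 t.zero_le
      rw [ha0, sub_zero] at h0
      rw [max_eq_left hd]
      linarith
    · have ht := (abs_le.mp (hf t le_rfl)).1
      have := hle t le_rfl
      rw [sub_self, mul_zero] at ht
      rw [max_eq_right hd]
      linarith
  · rw [sub_le_iff_le_add]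
    refine Finset.sup'_le h f fun s hs => ?_
    have hst : s ≤ t := Nat.le_of_lt_succ (Finset.mem_range.mp hs)
    obtain ⟨hs0, hsa⟩ := ha s hst
    have h1 := (abs_le.mp (hf s hst)).2
    have h2 : d * (a t - a s) ≤ max d 0 * (a t - a s) :=
      mul_le_mul_of_nonneg_right (le_max_left d 0) (sub_nonneg.mpr hsa)
    have h3 : 0 ≤ max d 0 * a s := mul_nonneg (le_max_right d 0) hs0
    linarith

/-- A maximum of absolute values over a nonempty finite set tends to zero as soon as all its terms
are bounded by a sequence tending to zero. -/
theorem tendsto_sup'_abs_zero_of_le {ι : Type*} {s : Finset ι} (hs : s.Nonempty)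
    {f : ℕ → ι → ℝ} {e : ℕ → ℝ} (he : Tendsto e atTop (𝓝 0)) (hf : ∀ n, ∀ i ∈ s, |f n i| ≤ e n) :
    Tendsto (fun n => s.sup' hs fun i => |f n i|) atTop (𝓝 0) := by
  obtain ⟨i, hi⟩ := hs
  exact squeeze_zero
    (fun n => (abs_nonneg (f n i)).trans (Finset.le_sup' (fun i => |f n i|) hi))
    (fun n => Finset.sup'_le _ _ (hf n)) he

/-- deterministic core of Lemma 3: convergence of waiting and treated mass.
If the cumulative arrivals `N n ·` converge uniformly on `{0,…,τ}` to `c·a` and the cumulative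
budgets `B n ·` converge uniformly to `β·a`, with `a` nondecreasing and `a 0 = 0`, then the
Lindley waiting mass `W n t` converges uniformly to `(c-β)₊·a t` and the treated mass
`T n t = N n t - W n t` converges uniformly to `min β c · a t`. -/
theorem waiting_and_treated_mass_uniform_convergence
    (τ : ℕ) (a : ℕ → ℝ) (ha0 : a 0 = 0)
    (hamono : ∀ s t : ℕ, s ≤ t → t ≤ τ → a s ≤ a t)
    (c β : ℝ) (hc : 0 ≤ c) (hβ : 0 ≤ β)
    (N B : ℕ → ℕ → ℝ)
    (hN0 : ∀ n, N n 0 = 0) (hB0 : ∀ n, B n 0 = 0)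
    (hNconv : Tendsto
      (fun n => (Finset.range (τ + 1)).sup' (Finset.nonempty_range_iff.mpr τ.succ_ne_zero)
        (fun t => |N n t - c * a t|)) atTop (𝓝 0))
    (hBconv : Tendsto
      (fun n => (Finset.range (τ + 1)).sup' (Finset.nonempty_range_iff.mpr τ.succ_ne_zero)
        (fun t => |B n t - β * a t|)) atTop (𝓝 0))
    (W T : ℕ → ℕ → ℝ)
    (hW : ∀ n t, W n t
      = (Finset.range (t + 1)).sup' (Finset.nonempty_range_iff.mpr t.succ_ne_zero)
        (fun s => (N n t - N n s) - (B n t - B n s)))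
    (hT : ∀ n t, T n t = N n t - W n t) :
    Tendsto
      (fun n => (Finset.range (τ + 1)).sup' (Finset.nonempty_range_iff.mpr τ.succ_ne_zero)
        (fun t => |W n t - max (c - β) 0 * a t|)) atTop (𝓝 0)
    ∧ Tendsto
      (fun n => (Finset.range (τ + 1)).sup' (Finset.nonempty_range_iff.mpr τ.succ_ne_zero)
        (fun t => |T n t - min β c * a t|)) atTop (𝓝 0) := by
  set eN := fun n => (Finset.range (τ + 1)).sup' (Finset.nonempty_range_iff.mpr τ.succ_ne_zero)
    (fun t => |N n t - c * a t|)
  set eB := fun n => (Finset.range (τ + 1)).sup' (Finset.nonempty_range_iff.mpr τ.succ_ne_zero)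
    (fun t => |B n t - β * a t|)
  have hN : ∀ n, ∀ t ≤ τ, |N n t - c * a t| ≤ eN n := fun n t ht =>
    Finset.le_sup' (fun t => |N n t - c * a t|) (Finset.mem_range.mpr (Nat.lt_succ_of_le ht))
  have hB : ∀ n, ∀ t ≤ τ, |B n t - β * a t| ≤ eB n := fun n t ht =>
    Finset.le_sup' (fun t => |B n t - β * a t|) (Finset.mem_range.mpr (Nat.lt_succ_of_le ht))
  have hWbound : ∀ n, ∀ t ≤ τ, |W n t - max (c - β) 0 * a t| ≤ 2 * (eN n + eB n) := by
    intro n t ht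
    rw [hW]
    refine abs_sup'_range_sub_max_zero_mul_le ha0
      (fun s hs => ⟨ha0 ▸ hamono 0 s s.zero_le (hs.trans ht), hamono s t hs ht⟩)
      (fun s hs => ?_) _
    have hNt := abs_le.mp (hN n t ht)
    have hNs := abs_le.mp (hN n s (hs.trans ht))
    have hBt := abs_le.mp (hB n t ht)
    have hBs := abs_le.mp (hB n s (hs.trans ht))
    rw [abs_le]
    constructor <;> linarith
  have hsum : Tendsto (fun n => 2 * (eN n + eB n)) atTop (𝓝 0) := by
    simpa using (hNconv.add hBconv).const_mul 2
  refine ⟨tendsto_sup'_abs_zero_of_le _ hsum fun n t ht =>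
      hWbound n t (Nat.le_of_lt_succ (Finset.mem_range.mp ht)),
    tendsto_sup'_abs_zero_of_le _ (by simpa using hNconv.add hsum) fun n t ht => ?_⟩
  have htτ : t ≤ τ := Nat.le_of_lt_succ (Finset.mem_range.mp ht)
  have hmin : min β c = c - max (c - β) 0 := by
    rcases le_total β c with h | h
    · rw [min_eq_left h, max_eq_left (sub_nonneg.mpr h), sub_sub_cancel]
    · rw [min_eq_right h, max_eq_right (sub_nonpos.mpr h), sub_zero]
  have hsplit : T n t - min β c * a t
      = (N n t - c * a t) - (W n t - max (c - β) 0 * a t) := by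
    rw [hT, hmin]
    ring
  rw [hsplit]
  exact (abs_sub _ _).trans (add_le_add (hN n t htτ) (hWbound n t htτ))
end

section
/- Let n ≥ 2, C ≥ 0, and let (X_1, Z_1), ..., (X_n, Z_n) be random pairs on a common probability space such that the X_i are identically distributed, each Z_i takes values in {0,1}, π is a measurable function with values in [0,1], g is a measurable real function with E[g(X_1)²] < ∞, and for all i ≠ j, |E[(Z_i − π(X_i))(Z_j − π(X_j)) | X_i, X_j]| ≤ C/n almost surely. Then E[ ( Σ_{i=1}^n (Z_i − π(X_i))·g(X_i) )² ] ≤ (1 + C)·n·E[g(X_1)²]. -/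
open MeasureTheory

/-- If the conditional expectation of `f` is bounded by `c` in absolute value, then integrating `f`
against an `m`-measurable weight `h` gives at most `c` times the integral of `|h|`. -/
theorem integral_mul_le_of_abs_condExp_le {Ω : Type*} {m m0 : MeasurableSpace Ω} {μ : Measure Ω}
    [IsFiniteMeasure μ] (hm : m ≤ m0) {f h : Ω → ℝ} {c : ℝ}
    (hf : Integrable f μ) (hh : Integrable h μ) (hfh : Integrable (f * h) μ)
    (hhm : StronglyMeasurable[m] h) (hc : ∀ᵐ ω ∂μ, |(μ[f | m]) ω| ≤ c) :
    ∫ ω, f ω * h ω ∂μ ≤ c * ∫ ω, |h ω| ∂μ := by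
  have hpull : μ[f * h | m] =ᵐ[μ] μ[f | m] * h :=
    condExp_mul_of_stronglyMeasurable_right hhm hfh hf
  calc ∫ ω, f ω * h ω ∂μ = ∫ ω, (μ[f * h | m]) ω ∂μ := (integral_condExp hm).symm
    _ ≤ ∫ ω, c * |h ω| ∂μ := by
      refine integral_mono_ae integrable_condExp (hh.abs.const_mul c) ?_
      filter_upwards [hpull, hc] with ω h1 h2
      rw [h1, Pi.mul_apply]
      calc _ ≤ |(μ[f | m]) ω * h ω| := le_abs_self _
        _ = |(μ[f | m]) ω| * |h ω| := abs_mul _ _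
        _ ≤ c * |h ω| := mul_le_mul_of_nonneg_right h2 (abs_nonneg _)
    _ = c * ∫ ω, |h ω| ∂μ := integral_const_mul _ _

/-- second-moment bound for the nuisance remainder under weak pairwise
dependence. If the `X i` are identically distributed, `Z i ∈ {0,1}`, `p` takes values
in `[0,1]`, `E[g(X 0)²] < ∞`, and the pairwise conditional covariances of the centered
treatments are bounded by `C/n`, then
`E[(∑ i (Z i - p(X i))·g(X i))²] ≤ (1 + C)·n·E[g(X 0)²]`. -/
theorem centered_treatment_weighted_sum_second_moment
    {Ω E : Type*} [MeasurableSpace Ω] [MeasurableSpace E]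
    (μ : Measure Ω) [IsProbabilityMeasure μ]
    (n : ℕ) (hn : 2 ≤ n) (C : ℝ) (hC : 0 ≤ C)
    (X : Fin n → Ω → E) (Z : Fin n → Ω → ℝ)
    (hXm : ∀ i, Measurable (X i)) (hZm : ∀ i, Measurable (Z i))
    (hZ01 : ∀ i ω, Z i ω = 0 ∨ Z i ω = 1)
    (hident : ∀ i j, Measure.map (X i) μ = Measure.map (X j) μ)
    (p : E → ℝ) (hpm : Measurable p) (hp01 : ∀ x, 0 ≤ p x ∧ p x ≤ 1)
    (g : E → ℝ) (hgm : Measurable g)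
    (hg2 : Integrable (fun ω => g (X ⟨0, by omega⟩ ω) ^ 2) μ)
    (hcov : ∀ i j : Fin n, i ≠ j →
      ∀ᵐ ω ∂μ,
        |(μ[(fun ω' => (Z i ω' - p (X i ω')) * (Z j ω' - p (X j ω'))) |
            MeasurableSpace.comap (fun ω' => (X i ω', X j ω')) inferInstance]) ω|
          ≤ C / n) :
    ∫ ω, (∑ i, (Z i ω - p (X i ω)) * g (X i ω)) ^ 2 ∂μ
      ≤ (1 + C) * n * ∫ ω, g (X ⟨0, by omega⟩ ω) ^ 2 ∂μ := by
  set V := ∫ ω, g (X ⟨0, by omega⟩ ω) ^ 2 ∂μ with hV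
  have hn0 : (0 : ℝ) < n := by exact_mod_cast (by omega : 0 < n)
  have hV0 : 0 ≤ V := integral_nonneg fun ω => sq_nonneg _
  have hid : ∀ i, ProbabilityTheory.IdentDistrib (fun ω => g (X i ω) ^ 2)
      (fun ω => g (X ⟨0, by omega⟩ ω) ^ 2) μ μ := fun i =>
    ProbabilityTheory.IdentDistrib.comp (u := fun x => g x ^ 2)
      ⟨(hXm i).aemeasurable, (hXm _).aemeasurable, hident i _⟩ (hgm.pow_const 2)
  have hsq : ∀ i, Integrable (fun ω => g (X i ω) ^ 2) μ := fun i =>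
    (hid i).integrable_iff.mpr hg2
  have hint : ∀ i, ∫ ω, g (X i ω) ^ 2 ∂μ = V := fun i => (hid i).integral_eq
  have hL2 : ∀ i, MemLp (fun ω => g (X i ω)) 2 μ := fun i =>
    (memLp_two_iff_integrable_sq (hgm.comp (hXm i)).aestronglyMeasurable).mpr (hsq i)
  have hG : ∀ i j, Integrable (fun ω => g (X i ω) * g (X j ω)) μ := fun i j =>
    (hL2 i).integrable_mul (hL2 j)
  have he : ∀ i ω, |Z i ω - p (X i ω)| ≤ 1 := by
    intro i ω
    have := hp01 (X i ω)
    rw [abs_le]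
    rcases hZ01 i ω with h | h <;> rw [h] <;> constructor <;> linarith
  have heem : ∀ i j, Measurable
      (fun ω => (Z i ω - p (X i ω)) * (Z j ω - p (X j ω))) := fun i j =>
    ((hZm i).sub (hpm.comp (hXm i))).mul ((hZm j).sub (hpm.comp (hXm j)))
  have hee : ∀ i j ω, ‖(Z i ω - p (X i ω)) * (Z j ω - p (X j ω))‖ ≤ 1 := by
    intro i j ω
    rw [Real.norm_eq_abs, abs_mul]
    exact mul_le_one₀ (he i ω) (abs_nonneg _) (he j ω)
  have heeG : ∀ i j, Integrable (fun ω => (Z i ω - p (X i ω)) * (Z j ω - p (X j ω)) *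
      (g (X i ω) * g (X j ω))) μ := fun i j =>
    (hG i j).bdd_mul (heem i j).aestronglyMeasurable (Filter.Eventually.of_forall (hee i j))
  have hGabs : ∀ i j, ∫ ω, |g (X i ω) * g (X j ω)| ∂μ ≤ V := by
    intro i j
    calc ∫ ω, |g (X i ω) * g (X j ω)| ∂μ
        ≤ ∫ ω, (g (X i ω) ^ 2 + g (X j ω) ^ 2) / 2 ∂μ := by
          refine integral_mono (hG i j).abs (((hsq i).add (hsq j)).div_const 2) fun ω => ?_
          simp only [abs_mul]
          nlinarith [sq_nonneg (|g (X i ω)| - |g (X j ω)|), sq_abs (g (X i ω)),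
            sq_abs (g (X j ω))]
      _ = V := by
          rw [integral_div, integral_add (hsq i) (hsq j), hint i, hint j]
          ring
  have hterm : ∀ i j, ∫ ω, (Z i ω - p (X i ω)) * (Z j ω - p (X j ω)) *
      (g (X i ω) * g (X j ω)) ∂μ ≤ (if i = j then V else 0) + C / n * V := by
    intro i j
    have hCV : 0 ≤ C / n * V := by positivity
    split_ifs with hij
    · subst hij
      have hdiag : ∫ ω, (Z i ω - p (X i ω)) * (Z i ω - p (X i ω)) *
          (g (X i ω) * g (X i ω)) ∂μ ≤ ∫ ω, |g (X i ω) * g (X i ω)| ∂μ := by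
        refine integral_mono (heeG i i) (hG i i).abs fun ω => ?_
        refine (le_abs_self _).trans ?_
        rw [abs_mul]
        exact mul_le_of_le_one_left (abs_nonneg _) (hee i i ω)
      linarith [hGabs i i]
    · rw [zero_add]
      have hpair : Measurable (fun ω => (X i ω, X j ω)) := (hXm i).prodMk (hXm j)
      have hw : Measurable fun x : E × E => g x.1 * g x.2 :=
        (hgm.comp measurable_fst).mul (hgm.comp measurable_snd)
      refine (integral_mul_le_of_abs_condExp_le hpair.comap_le
        (Integrable.of_bound (heem i j).aestronglyMeasurable 1
          (Filter.Eventually.of_forall (hee i j))) (hG i j) (heeG i j)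
        (hw.comp (comap_measurable _)).stronglyMeasurable (hcov i j hij)).trans ?_
      exact mul_le_mul_of_nonneg_left (hGabs i j) (by positivity)
  calc ∫ ω, (∑ i, (Z i ω - p (X i ω)) * g (X i ω)) ^ 2 ∂μ
      = ∫ ω, ∑ i, ∑ j, (Z i ω - p (X i ω)) * (Z j ω - p (X j ω)) *
          (g (X i ω) * g (X j ω)) ∂μ := by
        congr 1
        ext ω
        rw [sq, Finset.sum_mul_sum]
        exact Finset.sum_congr rfl fun i _ => Finset.sum_congr rfl fun j _ => by ring
    _ = ∑ i, ∑ j, ∫ ω, (Z i ω - p (X i ω)) * (Z j ω - p (X j ω)) *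
          (g (X i ω) * g (X j ω)) ∂μ := by
        rw [integral_finsetSum _ fun i _ => integrable_finsetSum _ fun j _ => heeG i j]
        exact Finset.sum_congr rfl fun i _ => integral_finsetSum _ fun j _ => heeG i j
    _ ≤ ∑ i : Fin n, ∑ j : Fin n, ((if i = j then V else 0) + C / n * V) :=
        Finset.sum_le_sum fun i _ => Finset.sum_le_sum fun j _ => hterm i j
    _ = (1 + C) * n * V := by
        simp only [Finset.sum_add_distrib, Finset.sum_ite_eq, Finset.mem_univ, if_true,
          Finset.sum_const, Finset.card_univ, Fintype.card_fin, nsmul_eq_mul]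
        field_simp
end

section
/- For each n, let T_{1,n} and T_{2,n} be real random variables on a probability space with a sub-σ-algebra H_n such that T_{2,n} is H_n-measurable. Let V1 ≥ 0 and V2 ≥ 0 be constants. Suppose that for every t ∈ ℝ, the conditional characteristic function E[exp(i·t·T_{1,n}) | H_n] converges in probability to exp(−t²·V1/2) as n → ∞, and that T_{2,n} converges in distribution to the normal law N(0, V2). Then T_{1,n} converges in distribution to N(0, V1), and T_{1,n} + T_{2,n} converges in distribution to N(0, V1 + V2). -/
open MeasureTheory ProbabilityTheory Filter Topology
open scoped NNReal

section

variable {Ω : Type*} [mΩ : MeasurableSpace Ω] {μ : Measure Ω}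

/-- Weak convergence of the laws of real random variables, tested on bounded continuous functions,
is equivalent to pointwise convergence of the characteristic functions. -/
theorem forall_tendsto_integral_iff_tendsto_charFun [IsProbabilityMeasure μ]
    {X : ℕ → Ω → ℝ} (hX : ∀ n, Measurable (X n)) (ν : Measure ℝ) [IsProbabilityMeasure ν] :
    (∀ f : BoundedContinuousFunction ℝ ℝ,
      Tendsto (fun n => ∫ ω, f (X n ω) ∂μ) atTop (𝓝 (∫ x, f x ∂ν))) ↔
    ∀ t : ℝ, Tendsto (fun n => ∫ ω, Complex.exp (Complex.I * t * X n ω) ∂μ) atTop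
      (𝓝 (charFun ν t)) := by
  let P (n : ℕ) : ProbabilityMeasure ℝ :=
    ⟨μ.map (X n), Measure.isProbabilityMeasure_map (hX n).aemeasurable⟩
  let Q : ProbabilityMeasure ℝ := ⟨ν, inferInstance⟩
  have h := (ProbabilityMeasure.tendsto_iff_forall_integral_tendsto (μs := P) (μ := Q)
    (F := atTop)).symm.trans ProbabilityMeasure.tendsto_iff_tendsto_charFun
  have hf (n : ℕ) (f : BoundedContinuousFunction ℝ ℝ) :
      ∫ x, f x ∂(μ.map (X n)) = ∫ ω, f (X n ω) ∂μ :=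
    integral_map (hX n).aemeasurable f.continuous.aestronglyMeasurable
  have hc (n : ℕ) (t : ℝ) :
      charFun (μ.map (X n)) t = ∫ ω, Complex.exp (Complex.I * t * X n ω) ∂μ := by
    rw [charFun_apply_real, integral_map (hX n).aemeasurable (by fun_prop)]
    congr with ω
    ring_nf
  simpa only [P, Q, ProbabilityMeasure.coe_mk, hf, hc] using h

/-- Convergence in measure of a uniformly bounded sequence to a constant implies convergence
in mean. -/
theorem tendsto_integral_norm_sub_of_tendstoInMeasure_const [IsFiniteMeasure μ]
    {E : Type*} [NormedAddCommGroup E] {f : ℕ → Ω → E} {c : E} {R : ℝ}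
    (hf : ∀ n, AEStronglyMeasurable (f n) μ) (hR : ∀ n, ∀ᵐ ω ∂μ, ‖f n ω‖ ≤ R)
    (hfc : TendstoInMeasure μ f atTop (fun _ => c)) :
    Tendsto (fun n => ∫ ω, ‖f n ω - c‖ ∂μ) atTop (𝓝 0) := by
  refine tendsto_of_subseq_tendsto fun ns hns => ?_
  obtain ⟨ms, -, hms⟩ := (hfc.comp hns).exists_seq_tendsto_ae
  refine ⟨ms, ?_⟩
  have := tendsto_integral_of_dominated_convergence (μ := μ)
    (F := fun n ω => ‖f (ns (ms n)) ω - c‖) (f := fun _ => 0) (fun _ => R + ‖c‖)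
    (fun n => ((hf _).sub aestronglyMeasurable_const).norm) (integrable_const _)
    (fun n => by
      filter_upwards [hR (ns (ms n))] with ω hω
      rw [norm_norm]
      exact (norm_sub_le _ _).trans (by gcongr))
    (by
      filter_upwards [hms] with ω hω
      exact tendsto_iff_norm_sub_tendsto_zero.1 hω)
  simpa using this

/-- If the conditional expectations of bounded `Y n` given `H n` converge in probability to a
constant `c`, then for bounded `H n`-measurable `Z n` whose means converge to `z`, the means of
`Y n * Z n` converge to `c * z`. -/
theorem tendsto_integral_mul_of_tendstoInMeasure_condExp [IsProbabilityMeasure μ]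
    {H : ℕ → MeasurableSpace Ω} (hH : ∀ n, H n ≤ mΩ) {Y Z : ℕ → Ω → ℂ} {c z : ℂ}
    (hYm : ∀ n, AEStronglyMeasurable (Y n) μ) (hY : ∀ n ω, ‖Y n ω‖ ≤ 1)
    (hZm : ∀ n, StronglyMeasurable[H n] (Z n)) (hZ : ∀ n ω, ‖Z n ω‖ ≤ 1)
    (hc : TendstoInMeasure μ (fun n => μ[Y n | H n]) atTop (fun _ => c))
    (hz : Tendsto (fun n => ∫ ω, Z n ω ∂μ) atTop (𝓝 z)) :
    Tendsto (fun n => ∫ ω, Y n ω * Z n ω ∂μ) atTop (𝓝 (c * z)) := by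
  have hZm' (n : ℕ) : AEStronglyMeasurable (Z n) μ := ((hZm n).mono (hH n)).aestronglyMeasurable
  have hYi (n : ℕ) : Integrable (Y n) μ := .of_bound (hYm n) 1 (ae_of_all _ (hY n))
  have hZi (n : ℕ) : Integrable (Z n) μ := .of_bound (hZm' n) 1 (ae_of_all _ (hZ n))
  have hYZi (n : ℕ) : Integrable (fun ω => Y n ω * Z n ω) μ :=
    (hYi n).mul_bdd (hZm' n) (ae_of_all _ (hZ n))
  have hCZi (n : ℕ) : Integrable (fun ω => μ[Y n | H n] ω * Z n ω) μ :=
    Integrable.mul_bdd (c := 1) integrable_condExp (hZm' n) (ae_of_all _ (hZ n))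
  have hpull (n : ℕ) : ∫ ω, Y n ω * Z n ω ∂μ = ∫ ω, μ[Y n | H n] ω * Z n ω ∂μ := by
    rw [← integral_condExp (hH n)]
    exact integral_congr_ae (condExp_bilin_of_stronglyMeasurable_right
      (ContinuousLinearMap.mul ℝ ℂ) (hZm n) (hYZi n) (hYi n))
  have hdiff : Tendsto (fun n => ∫ ω, (μ[Y n | H n] ω - c) * Z n ω ∂μ) atTop (𝓝 0) := by
    refine squeeze_zero_norm (fun n => ?_) (tendsto_integral_norm_sub_of_tendstoInMeasure_const
      (fun n => integrable_condExp.aestronglyMeasurable)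
      (fun n => ae_bdd_norm_condExp_of_ae_bdd_norm (ae_of_all _ (hY n))) hc)
    refine norm_integral_le_of_norm_le (integrable_condExp.sub (integrable_const c)).norm
      (ae_of_all _ fun ω => ?_)
    rw [norm_mul]
    exact mul_le_of_le_one_right (norm_nonneg _) (hZ n ω)
  refine (by simpa using hdiff.add (hz.const_mul c) : Tendsto _ atTop (𝓝 (c * z))).congr fun n => ?_
  simp_rw [sub_mul]
  rw [integral_sub (hCZi n) ((hZi n).const_mul c), integral_const_mul, hpull, sub_add_cancel]

end

/-- stable-convergence lemma for the queue-design CLT.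
If the conditional characteristic functions of `T1 n` given `H n` converge in probability to
the `N(0, V1)` characteristic function, and the `H n`-measurable `T2 n` converge in
distribution to `N(0, V2)`, then `T1 n ⇒ N(0, V1)` and `T1 n + T2 n ⇒ N(0, V1 + V2)`
(convergence in distribution stated via bounded continuous test functions). -/
theorem conditional_clt_sum_asymptotically_normal
    {Ω : Type*} [mΩ : MeasurableSpace Ω]
    (μ : Measure Ω) [IsProbabilityMeasure μ]
    (H : ℕ → MeasurableSpace Ω) (hH : ∀ n, H n ≤ mΩ)
    (T1 T2 : ℕ → Ω → ℝ)
    (hT1m : ∀ n, Measurable (T1 n)) (hT2m : ∀ n, Measurable[H n] (T2 n))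
    (V1 V2 : ℝ≥0)
    (hcf : ∀ t : ℝ, TendstoInMeasure μ
      (fun n => μ[(fun ω => Complex.exp (Complex.I * t * T1 n ω)) | H n]) atTop
      (fun _ => Complex.exp (Complex.ofReal (-(t ^ 2 * (V1 : ℝ)) / 2))))
    (hT2conv : ∀ f : BoundedContinuousFunction ℝ ℝ,
      Tendsto (fun n => ∫ ω, f (T2 n ω) ∂μ) atTop
        (𝓝 (∫ x, f x ∂(gaussianReal 0 V2)))) :
    (∀ f : BoundedContinuousFunction ℝ ℝ,
      Tendsto (fun n => ∫ ω, f (T1 n ω) ∂μ) atTop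
        (𝓝 (∫ x, f x ∂(gaussianReal 0 V1))))
    ∧ (∀ f : BoundedContinuousFunction ℝ ℝ,
      Tendsto (fun n => ∫ ω, f (T1 n ω + T2 n ω) ∂μ) atTop
        (𝓝 (∫ x, f x ∂(gaussianReal 0 (V1 + V2))))) := by
  have hnorm (t x : ℝ) : ‖Complex.exp (Complex.I * t * x)‖ ≤ 1 := by
    simp [Complex.norm_exp]
  have hT2 (n : ℕ) : Measurable (T2 n) := (hT2m n).mono (hH n) le_rfl
  rw [forall_tendsto_integral_iff_tendsto_charFun hT2] at hT2conv
  rw [forall_tendsto_integral_iff_tendsto_charFun hT1m,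
    forall_tendsto_integral_iff_tendsto_charFun (X := fun n ω => T1 n ω + T2 n ω)
      fun n => (hT1m n).add (hT2 n)]
  have hexp (n : ℕ) (t : ℝ) :
      AEStronglyMeasurable (fun ω => Complex.exp (Complex.I * t * T1 n ω)) μ := by
    have := hT1m n
    fun_prop
  refine ⟨fun t => ?_, fun t => ?_⟩
  · have h := tendsto_integral_mul_of_tendstoInMeasure_condExp hH (fun n => hexp n t)
      (fun n ω => hnorm t _) (Z := fun _ _ => 1) (fun n => stronglyMeasurable_const)
      (by simp) (hcf t) (z := 1) (by simp)
    simp only [mul_one] at h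
    convert h using 2
    rw [charFun_gaussianReal]
    push_cast
    ring_nf
  · have h := tendsto_integral_mul_of_tendstoInMeasure_condExp hH (fun n => hexp n t)
      (fun n ω => hnorm t _) (Z := fun n ω => Complex.exp (Complex.I * t * T2 n ω))
      (fun n => (Complex.measurable_exp.comp
        ((Complex.measurable_ofReal.comp (hT2m n)).const_mul _)).stronglyMeasurable)
      (fun n ω => hnorm t _) (hcf t) (hT2conv t)
    convert h using 2
    · congr with ω
      rw [← Complex.exp_add]
      push_cast
      ring_nf
    · rw [charFun_gaussianReal, charFun_gaussianReal, ← Complex.exp_add]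
      push_cast
      ring_nf
end
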